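/- Let (K, v, δ) be a differentially henselian field and A a differentially finitely generated K-algebra. If φ : A → K is an isolated K-rational point (i.e., there is a finite differential generating set ā = (a_i)_{i<n} of A and γ ∈ vK such that every K-algebra homomorphism ψ : A → K with v(φ(a_i) − ψ(a_i)) > γ for all i equals φ), then φ is a differential K-algebra homomorphism. -/

import Mathlib

section Asymptotics

variable {K Γ₀ : Type*} [Field K] [LinearOrderedCommGroupWithZero Γ₀] (v : Valuation K Γ₀)

/-- The filter of punctured neighbourhoods of `0` for the valuation topology. -/
def puncturedZero : Filter K :=
  ⨅ ε : {x : K // x ≠ 0}, Filter.principal {τ | τ ≠ 0 ∧ v τ < v ε}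

lemma puncturedZero_hasBasis :
    (puncturedZero v).HasBasis (fun _ : {x : K // x ≠ 0} => True)
      fun ε => {τ | τ ≠ 0 ∧ v τ < v ε} := by
  have : Nonempty {x : K // x ≠ 0} := ⟨⟨1, one_ne_zero⟩⟩
  refine Filter.hasBasis_iInf_principal ?_
  intro a b
  rcases le_total (v a) (v b) with h | h
  · exact ⟨a, fun τ hτ => hτ, fun τ hτ => ⟨hτ.1, hτ.2.trans_le h⟩⟩
  · exact ⟨b, fun τ hτ => ⟨hτ.1, hτ.2.trans_le h⟩, fun τ hτ => hτ⟩

lemma eventually_ne_zero : ∀ᶠ τ in puncturedZero v, τ ≠ 0 :=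
  (puncturedZero_hasBasis v).eventually_iff.2 ⟨⟨1, one_ne_zero⟩, trivial, fun _ h => h.1⟩

lemma eventually_lt {ε : K} (hε : ε ≠ 0) : ∀ᶠ τ in puncturedZero v, v τ < v ε :=
  (puncturedZero_hasBasis v).eventually_iff.2 ⟨⟨ε, hε⟩, trivial, fun _ h => h.2⟩

lemma eventually_mul_lt (C : K) {c : K} (hc : c ≠ 0) :
    ∀ᶠ τ in puncturedZero v, v C * v τ < v c := by
  rcases eq_or_ne C 0 with rfl | hC
  · simp [zero_lt_iff, hc]
  · filter_upwards [eventually_lt v (div_ne_zero hc hC)] with τ hτ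
    rw [map_div₀] at hτ
    rwa [mul_comm, ← lt_div_iff₀ (zero_lt_iff.2 ((v.ne_zero_iff).2 hC))]

/-- `X τ = O(τ ^ N)` as `τ` tends to `0`. -/
def BigO (N : ℕ) (X : K → K) : Prop :=
  ∃ C : K, ∀ᶠ τ in puncturedZero v, v (X τ) ≤ v C * v τ ^ N

variable {v}

namespace BigO

lemma mono {M N : ℕ} (h : M ≤ N) {X : K → K} (hX : BigO v N X) : BigO v M X := by
  obtain ⟨C, hC⟩ := hX
  refine ⟨C, ?_⟩
  filter_upwards [hC, eventually_lt v one_ne_zero] with τ h1 h2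
  rw [map_one] at h2
  exact h1.trans (mul_le_mul_right (pow_le_pow_of_le_one zero_le h2.le h) _)

lemma add {N : ℕ} {X Y : K → K} (hX : BigO v N X) (hY : BigO v N Y) :
    BigO v N fun τ => X τ + Y τ := by
  obtain ⟨C, hC⟩ := hX
  obtain ⟨D, hD⟩ := hY
  obtain ⟨E, h1, h2⟩ : ∃ E, v C ≤ v E ∧ v D ≤ v E := by
    rcases le_total (v C) (v D) with h | h
    exacts [⟨D, h, le_rfl⟩, ⟨C, le_rfl, h⟩]
  refine ⟨E, ?_⟩
  filter_upwards [hC, hD] with τ hc hd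
  exact v.map_add_le (hc.trans (mul_le_mul_left h1 _)) (hd.trans (mul_le_mul_left h2 _))

lemma mul {M N : ℕ} {X Y : K → K} (hX : BigO v M X) (hY : BigO v N Y) :
    BigO v (M + N) fun τ => X τ * Y τ := by
  obtain ⟨C, hC⟩ := hX
  obtain ⟨D, hD⟩ := hY
  refine ⟨C * D, ?_⟩
  filter_upwards [hC, hD] with τ hc hd
  rw [map_mul, map_mul, pow_add, mul_mul_mul_comm]
  exact mul_le_mul' hc hd

lemma const (c : K) : BigO v 0 fun _ => c := ⟨c, by simp⟩

lemma neg {N : ℕ} {X : K → K} (hX : BigO v N X) : BigO v N fun τ => -X τ := by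
  obtain ⟨C, hC⟩ := hX
  exact ⟨C, by simpa only [Valuation.map_neg] using hC⟩

lemma sub {N : ℕ} {X Y : K → K} (hX : BigO v N X) (hY : BigO v N Y) :
    BigO v N fun τ => X τ - Y τ := by
  simpa only [sub_eq_add_neg] using hX.add hY.neg

lemma pow_id (N : ℕ) : BigO v N fun τ : K => τ ^ N := ⟨1, by simp⟩

lemma congr {N : ℕ} {X Y : K → K} (hX : BigO v N X)
    (h : ∀ᶠ τ in puncturedZero v, X τ = Y τ) : BigO v N Y := by
  obtain ⟨C, hC⟩ := hX
  refine ⟨C, ?_⟩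
  filter_upwards [hC, h] with τ h1 h2
  rwa [← h2]

lemma eval_polynomial (P : Polynomial K) : BigO v 0 fun τ => P.eval τ := by
  induction P using Polynomial.induction_on' with
  | add p q hp hq => simpa only [Polynomial.eval_add] using hp.add hq
  | monomial n a =>
    simpa only [Polynomial.eval_monomial] using
      (const a).mul ((pow_id (v := v) n).mono (Nat.zero_le n))

lemma eval_polynomial_of_dvd {N : ℕ} {P : Polynomial K} (h : Polynomial.X ^ N ∣ P) :
    BigO v N fun τ => P.eval τ := by
  obtain ⟨Q, rfl⟩ := h
  simpa using (pow_id N).mul (eval_polynomial (v := v) Q)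

end BigO

variable (v) in
/-- The function `X` agrees with the formal power series `p` up to order `N` near `0`. -/
def Asymp (N : ℕ) (X : K → K) (p : PowerSeries K) : Prop :=
  ∃ P : Polynomial K, (PowerSeries.X ^ N ∣ p - (P : PowerSeries K)) ∧
    BigO v N fun τ => X τ - P.eval τ

lemma PowerSeries.exists_polynomial_X_pow_dvd_sub (N : ℕ) (p : PowerSeries K) :
    ∃ P : Polynomial K, PowerSeries.X ^ N ∣ p - (P : PowerSeries K) := by
  refine ⟨PowerSeries.trunc N p, PowerSeries.X_pow_dvd_iff.2 fun m hm => ?_⟩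
  simp [PowerSeries.coeff_trunc, hm]

namespace Asymp

variable {M N : ℕ} {X Y : K → K} {p q : PowerSeries K}

lemma mono (h : M ≤ N) (hX : Asymp v N X p) : Asymp v M X p := by
  obtain ⟨P, h1, h2⟩ := hX
  exact ⟨P, (pow_dvd_pow _ h).trans h1, h2.mono h⟩

lemma congr (hX : Asymp v N X p) (h : ∀ᶠ τ in puncturedZero v, X τ = Y τ) :
    Asymp v N Y p := by
  obtain ⟨P, h1, h2⟩ := hX
  refine ⟨P, h1, h2.congr ?_⟩
  filter_upwards [h] with τ hτ
  rw [hτ]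

lemma bigO_sub (hX : Asymp v N X p) {P : Polynomial K}
    (hP : PowerSeries.X ^ N ∣ p - (P : PowerSeries K)) :
    BigO v N fun τ => X τ - P.eval τ := by
  obtain ⟨Q, h1, h2⟩ := hX
  have h3 : Polynomial.X ^ N ∣ Q - P := by
    rw [Polynomial.X_pow_dvd_iff]
    intro d hd
    have := PowerSeries.X_pow_dvd_iff.1 (dvd_sub hP h1) d hd
    simpa using this
  refine (h2.add (BigO.eval_polynomial_of_dvd h3)).congr (.of_forall fun τ => ?_)
  simp

lemma bounded (hX : Asymp v N X p) : BigO v 0 X := by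
  obtain ⟨P, -, h2⟩ := hX
  refine ((h2.mono (Nat.zero_le N)).add (BigO.eval_polynomial P)).congr (.of_forall fun τ => ?_)
  simp

lemma of_polynomial {P : Polynomial K} (hP : PowerSeries.X ^ N ∣ p - (P : PowerSeries K)) :
    Asymp v N (fun τ => P.eval τ) p :=
  ⟨P, hP, 0, by simp⟩

lemma const (c : K) : Asymp v N (fun _ => c) (PowerSeries.C c) :=
  ⟨Polynomial.C c, by simp, 0, by simp⟩

lemma add (hX : Asymp v N X p) (hY : Asymp v N Y q) :
    Asymp v N (fun τ => X τ + Y τ) (p + q) := by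
  obtain ⟨P, h1, h2⟩ := hX
  obtain ⟨Q, h3, h4⟩ := hY
  refine ⟨P + Q, ?_, (h2.add h4).congr (.of_forall fun τ => ?_)⟩
  · rw [Polynomial.coe_add, add_sub_add_comm]
    exact dvd_add h1 h3
  · rw [Polynomial.eval_add, add_sub_add_comm]

lemma mul (hX : Asymp v N X p) (hY : Asymp v N Y q) :
    Asymp v N (fun τ => X τ * Y τ) (p * q) := by
  obtain ⟨P, h1, h2⟩ := id hX
  obtain ⟨Q, h3, h4⟩ := hY
  refine ⟨P * Q, ?_, ?_⟩
  · have : p * q - ((P * Q : Polynomial K) : PowerSeries K) = p * (q - Q) + (p - P) * Q := by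
      rw [Polynomial.coe_mul]; ring
    rw [this]
    exact dvd_add (h3.mul_left _) (h1.mul_right _)
  · have := (hX.bounded.mul h4).add (h2.mul (BigO.eval_polynomial Q) |>.mono (by simp))
    refine (this.mono (by simp)).congr (.of_forall fun τ => ?_)
    rw [Polynomial.eval_mul]; ring

lemma pow (hX : Asymp v N X p) (k : ℕ) : Asymp v N (fun τ => X τ ^ k) (p ^ k) := by
  induction k with
  | zero => simpa using const (v := v) (N := N) 1
  | succ k ih => simpa only [pow_succ] using ih.mul hX

lemma bigO_sub_coeff {d : ℕ} (hX : Asymp v N X p) (hd : d < N) (hp : PowerSeries.X ^ d ∣ p) :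
    BigO v (d + 1) fun τ => X τ - PowerSeries.coeff d p * τ ^ d := by
  have := (hX.mono (Nat.succ_le_of_lt hd)).bigO_sub
    (P := Polynomial.monomial d (PowerSeries.coeff d p)) ?_
  · simpa using this
  · rw [PowerSeries.X_pow_dvd_iff]
    intro m hm
    rcases (Nat.lt_succ_iff.1 hm).eq_or_lt with rfl | h
    · simp
    · simp [PowerSeries.X_pow_dvd_iff.1 hp m h, PowerSeries.coeff_monomial, h.ne]

lemma bigO_of_dvd {d : ℕ} (hX : Asymp v N X p) (hd : d ≤ N) (hp : PowerSeries.X ^ d ∣ p) :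
    BigO v d X := by
  simpa using (hX.mono hd).bigO_sub (P := 0) (by simpa using hp)

lemma eventually_eq (hX : Asymp v N X p) (hp : p ≠ 0) (hN : p.order.toNat < N) :
    ∃ c : K, c ≠ 0 ∧ ∀ᶠ τ in puncturedZero v, v (X τ) = v c * v τ ^ p.order.toNat := by
  set d := p.order.toNat
  refine ⟨PowerSeries.coeff d p, PowerSeries.coeff_order hp, ?_⟩
  have hc := PowerSeries.coeff_order hp
  obtain ⟨C, hC⟩ := hX.bigO_sub_coeff hN PowerSeries.X_pow_order_dvd
  filter_upwards [hC, eventually_mul_lt v C hc, eventually_ne_zero v] with τ h1 h2 h3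
  rw [← map_pow, ← map_mul]
  refine Valuation.map_eq_of_sub_lt v (h1.trans_lt ?_)
  rw [pow_succ', ← mul_assoc, map_mul, map_pow]
  exact mul_lt_mul_of_pos_right h2 (zero_lt_iff.2 (pow_ne_zero _ (v.ne_zero_iff.2 h3)))

lemma eventually_ne_zero (hX : Asymp v N X p) (hp : p ≠ 0) (hN : p.order.toNat < N) :
    ∀ᶠ τ in puncturedZero v, X τ ≠ 0 := by
  obtain ⟨c, hc, h⟩ := hX.eventually_eq hp hN
  filter_upwards [h, _root_.eventually_ne_zero v] with τ h1 h2
  rw [← v.ne_zero_iff, h1]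
  exact mul_ne_zero (v.ne_zero_iff.2 hc) (pow_ne_zero _ (v.ne_zero_iff.2 h2))

lemma bigO_div {Z : K → K} (hX : Asymp v M X p) (hp : p ≠ 0) (hM : p.order.toNat < M)
    (hZ : BigO v (N + p.order.toNat) Z) : BigO v N fun τ => Z τ / X τ := by
  obtain ⟨c, hc, h⟩ := hX.eventually_eq hp hM
  obtain ⟨C, hC⟩ := hZ
  refine ⟨C / c, ?_⟩
  filter_upwards [h, hC, _root_.eventually_ne_zero v] with τ h1 h2 h3
  have hc' := v.ne_zero_iff.2 hc
  have h3' := v.ne_zero_iff.2 h3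
  rw [map_div₀, h1, map_div₀, div_le_iff₀ (zero_lt_iff.2 (mul_ne_zero hc' (pow_ne_zero _ h3')))]
  refine h2.trans_eq ?_
  field_simp
  rw [pow_add, mul_assoc]

lemma div (hX : Asymp v M X p) (hp : p ≠ 0) (hM : N + p.order.toNat < M)
    (hY : Asymp v M Y (p * q)) : Asymp v N (fun τ => Y τ / X τ) q := by
  obtain ⟨Q, hQ⟩ := PowerSeries.exists_polynomial_X_pow_dvd_sub M q
  refine ⟨Q, (pow_dvd_pow _ (by omega)).trans hQ, ?_⟩
  obtain ⟨P, hP, -⟩ := id hX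
  have h1 : BigO v M fun τ => Y τ - X τ * Q.eval τ := by
    obtain ⟨R, hR, h2⟩ := hX.mul (of_polynomial (v := v) hQ)
    refine ((hY.bigO_sub hR).sub h2).congr (.of_forall fun τ => ?_)
    simp
  refine (hX.bigO_div hp (by omega) (h1.mono hM.le)).congr ?_
  filter_upwards [hX.eventually_ne_zero hp (by omega)] with τ hτ
  rw [sub_div, mul_div_cancel_left₀ _ hτ]

end Asymp

end Asymptotics

section Hensel

variable {K Γ₀ : Type*} [Field K] [LinearOrderedCommGroupWithZero Γ₀] {v : Valuation K Γ₀}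

open Polynomial in
/-- In a henselian valuation ring, `S ^ (n + 2) - S ^ (n + 1)` has a unit root after perturbing its
lower coefficients by elements of the maximal ideal. -/
lemma exists_root_one_sub_add (hH : HenselianLocalRing ↥v.valuationSubring) (n : ℕ)
    (m : ℕ → K) (hm : ∀ j, v (m j) < 1) :
    ∃ S : K, v S = 1 ∧
      S ^ (n + 2) - S ^ (n + 1) + ∑ j ∈ Finset.range (n + 1), m j * S ^ j = 0 := by
  set O := v.valuationSubring
  let μ : ℕ → O := fun j => ⟨m j, (hm j).le⟩
  have hμ : ∀ j, μ j ∈ IsLocalRing.maximalIdeal O := fun j => by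
    rw [Valuation.mem_maximalIdeal_iff]
    exact hm j
  have hsum : ∀ c : ℕ → O, ∑ j ∈ Finset.range (n + 1), μ j * c j ∈ IsLocalRing.maximalIdeal O :=
    fun c => Ideal.sum_mem _ fun j _ => Ideal.mul_mem_right _ _ (hμ j)
  let r : O[X] := -X ^ (n + 1) + ∑ j ∈ Finset.range (n + 1), C (μ j) * X ^ j
  have hr : r.degree < ((n + 2 : ℕ) : WithBot ℕ) := by
    refine lt_of_le_of_lt (b := ((n + 1 : ℕ) : WithBot ℕ)) ?_ (by exact_mod_cast Nat.lt_succ_self _)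
    refine (degree_add_le _ _).trans (max_le ?_ ?_)
    · rw [degree_neg]; exact degree_X_pow_le _
    · refine (degree_sum_le _ _).trans (Finset.sup_le fun j hj => ?_)
      refine (degree_C_mul_X_pow_le _ _).trans ?_
      exact_mod_cast (Finset.mem_range.1 hj).le
  have h0 : (X ^ (n + 2) + r).eval 1 ∈ IsLocalRing.maximalIdeal O := by
    simpa [r, eval_finsetSum] using hsum fun _ => 1
  have h1 : IsUnit ((X ^ (n + 2) + r).derivative.eval 1) := by
    have h : (X ^ (n + 2) + r).derivative.eval 1 =
        1 + ∑ j ∈ Finset.range (n + 1), μ j * (j : O) := by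
      simp [r, eval_finsetSum, derivative_X_pow]
      ring
    rw [h]
    by_contra hu
    have h2 := (IsLocalRing.mem_maximalIdeal _).2 hu
    have h3 := (Ideal.add_mem_iff_left _ (hsum fun j => (j : O))).1 h2
    exact (Ideal.ne_top_iff_one _).1 (IsLocalRing.maximalIdeal.isMaximal O).ne_top h3
  obtain ⟨s, hs, hs1⟩ := hH.is_henselian (X ^ (n + 2) + r) (monic_X_pow_add hr) 1 h0 h1
  refine ⟨s, ?_, ?_⟩
  · have h2 : v ((s : K) - 1) < 1 := by
      rw [Valuation.mem_maximalIdeal_iff] at hs1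
      exact hs1
    simpa using Valuation.map_eq_of_sub_lt v (x := (1 : K)) (by simpa using h2)
  · have := congrArg (fun x : O => (x : K)) hs.eq_zero
    simp only [eval_add, eval_pow, eval_X, neg_add_eq_sub, eval_sub, eval_finsetSum, eval_mul,
      eval_C, r, μ] at this
    push_cast at this
    rw [← this]; ring

open Polynomial in
/-- Henselian valuation rings: approximate simple roots of possibly non-monic polynomials lift. -/
lemma exists_root_of_coeff_le (hH : HenselianLocalRing ↥v.valuationSubring) (g : K[X]) (m : K)
    (hm : ∀ j, v (g.coeff j) ≤ v m) (h01 : v (g.coeff 0) < v (g.coeff 1))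
    (h : v m * v (g.coeff 0) < v (g.coeff 1) ^ 2) :
    ∃ z : K, g.eval z = 0 ∧ v z * v (g.coeff 1) ≤ v (g.coeff 0) := by
  have h1 : g.coeff 1 ≠ 0 := fun h0 => by simp [h0] at h01
  rcases eq_or_ne (g.coeff 0) 0 with h0 | h0
  · exact ⟨0, by rw [← coeff_zero_eq_eval_zero, h0], by simp⟩
  set a := g.coeff 0
  set b := g.coeff 1
  have hb : 0 < v b := zero_lt_iff.2 (v.ne_zero_iff.2 h1)
  set n := g.natDegree
  have hdeg : g.natDegree < n + 3 := by omega
  -- coefficients of the reciprocal polynomial, in decreasing order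
  let μ : ℕ → K := fun j => g.coeff (j + 2) * (-(a / b)) ^ (j + 2) / a
  have hab : v (-(a / b)) ≤ 1 := by
    rw [Valuation.map_neg, map_div₀]
    exact (div_le_one₀ hb).2 h01.le
  have hμ : ∀ j, v (μ j) < 1 := fun j => by
    have e : μ j = g.coeff (j + 2) * a / b ^ 2 * (-(a / b)) ^ j := by
      simp only [μ]
      rw [pow_add, neg_sq]
      field_simp
    rw [e, map_mul, map_pow]
    refine (mul_le_of_le_one_right' (pow_le_one' hab j)).trans_lt ?_
    rw [map_div₀, map_pow, map_mul, div_lt_one₀ (pow_pos hb 2)]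
    exact (mul_le_mul_left (hm _) _).trans_lt h
  obtain ⟨S, hS, hroot⟩ := exists_root_one_sub_add hH n (fun j => μ (n - j)) fun j => hμ _
  have hS0 : S ≠ 0 := fun h0 => by simp [h0] at hS
  refine ⟨-(a / b) / S, ?_, ?_⟩
  · rw [← Finset.sum_range_reflect] at hroot
    have key : g.eval (-(a / b) / S) * S ^ (n + 2) = a * 0 := by
      rw [← hroot, eval_eq_sum_range' hdeg, Finset.sum_range_succ', Finset.sum_range_succ', add_mul,
        add_mul, Finset.sum_mul, mul_add, Finset.mul_sum, mul_sub, add_comm, add_comm (∑ _ ∈ _, _),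
        ← add_assoc]
      congr 1
      · simp only [zero_add, pow_zero, pow_one, mul_one]
        change a * S ^ (n + 2) + b * (-(a / b) / S) * S ^ (n + 2) = _
        field_simp
        ring
      · refine Finset.sum_congr rfl fun j hj => ?_
        have hj := Finset.mem_range.1 hj
        have e1 : n - (n + 1 - 1 - j) = j := by omega
        rw [e1]
        obtain ⟨k, hk⟩ : ∃ k, n = j + k := ⟨n - j, by omega⟩
        have e2 : n + 1 - 1 - j = k := by omega
        have e3 : n + 2 = j + 2 + k := by omega
        simp only [μ]
        rw [e2, e3, div_pow, pow_add S (j + 2) k]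
        have : j + 1 + 1 = j + 2 := rfl
        rw [this]
        field_simp
    rw [mul_zero] at key
    exact (mul_eq_zero.1 key).resolve_right (pow_ne_zero _ hS0)
  · rw [map_div₀, hS, div_one, Valuation.map_neg, map_div₀, div_mul_cancel₀ _ hb.ne']
end Hensel

section Points

variable {K : Type*} [Field K]

lemma exists_algHom_of_le_range {P E : Type*} [CommRing P] [CommRing E] [Algebra K P] [Algebra K E]
    (π : P →ₐ[K] E) (χ : P →ₐ[K] K) (h : ∀ p, π p = 0 → χ p = 0)
    (C : Subalgebra K E) (hC : C ≤ π.range) :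
    ∃ χ' : C →ₐ[K] K, ∀ p (hp : π p ∈ C), χ' ⟨π p, hp⟩ = χ p := by
  have hker : RingHom.ker π.rangeRestrict.toRingHom ≤ RingHom.ker χ.toRingHom := by
    intro p hp
    exact h p (congrArg Subtype.val hp)
  refine ⟨(AlgHom.liftOfSurjective π.rangeRestrict π.rangeRestrict_surjective χ hker).comp
    (Subalgebra.inclusion hC), fun p hp => ?_⟩
  exact AlgHom.liftOfSurjective_apply π.rangeRestrict π.rangeRestrict_surjective χ hker p

variable {E : Type*} [CommRing E] [Algebra K E] (B : Subalgebra K E)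

lemma exists_algHom_of_algebraicIndependent {ι : Type*} {x : ι → E}
    (hx : AlgebraicIndependent B x) (ψ : B →ₐ[K] K) (y : ι → K) :
    ∃ χ : Algebra.adjoin K (B ∪ Set.range x) →ₐ[K] K,
      (∀ b : B, χ ⟨b, Algebra.subset_adjoin (Or.inl b.2)⟩ = ψ b) ∧
      ∀ i, χ ⟨x i, Algebra.subset_adjoin (Or.inr ⟨i, rfl⟩)⟩ = y i := by
  let _ : Algebra B K := ψ.toRingHom.toAlgebra
  have : IsScalarTower K B K := IsScalarTower.of_algebraMap_eq' ψ.comp_algebraMap.symm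
  obtain ⟨χ, hχ⟩ := exists_algHom_of_le_range
    ((MvPolynomial.aeval (R := B) x).restrictScalars K)
    ((MvPolynomial.aeval (R := B) y).restrictScalars K)
    (fun p hp => by
      have : p = 0 := hx (by simpa using hp)
      rw [this, map_zero])
    (Algebra.adjoin K (B ∪ Set.range x)) (by
      rw [← Algebra.restrictScalars_adjoin, Algebra.adjoin_range_eq_range_aeval]
      exact fun _ h => h)
  refine ⟨χ, fun b => ?_, fun i => ?_⟩
  · have := hχ (MvPolynomial.C b)
    simp only [AlgHom.restrictScalars_apply, MvPolynomial.aeval_C] at this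
    exact this (Algebra.subset_adjoin (Or.inl b.2))
  · have := hχ (MvPolynomial.X i)
    simp only [AlgHom.restrictScalars_apply, MvPolynomial.aeval_X] at this
    exact this (Algebra.subset_adjoin (Or.inr ⟨i, rfl⟩))

open Polynomial in
lemma exists_algHom_of_root [IsDomain E] (w : E) (f : Polynomial B) (hf0 : f ≠ 0)
    (hfw : aeval w f = 0)
    (hmin : ∀ g : Polynomial B, aeval w g = 0 → g.degree < f.degree → g = 0)
    (ψ : B →ₐ[K] K) (hψ : ψ f.leadingCoeff ≠ 0) (y : K)
    (hy : (f.map (ψ : B →+* K)).eval y = 0) :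
    ∃ χ : Algebra.adjoin K (B ∪ {w}) →ₐ[K] K,
      (∀ b : B, χ ⟨b, Algebra.subset_adjoin (Or.inl b.2)⟩ = ψ b) ∧
      χ ⟨w, Algebra.subset_adjoin (Or.inr rfl)⟩ = y := by
  let _ : Algebra B K := ψ.toRingHom.toAlgebra
  have : IsScalarTower K B K := IsScalarTower.of_algebraMap_eq' ψ.comp_algebraMap.symm
  have hy' : aeval y f = 0 := by rw [← hy, eval_map]; rfl
  have hker : ∀ n, ∀ g : Polynomial B, g.natDegree < n → aeval w g = 0 → aeval y g = 0 := by
    intro n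
    induction n with
    | zero => intro g hg; omega
    | succ n ih =>
      intro g hg hgw
      by_cases hd : g.degree < f.degree
      · rw [hmin g hgw hd, map_zero]
      have hg0 : g ≠ 0 := by
        rintro rfl
        rw [degree_zero] at hd
        exact hd (bot_lt_iff_ne_bot.2 (degree_ne_bot.2 hf0))
      have hle : f.natDegree ≤ g.natDegree := natDegree_le_natDegree (not_lt.1 hd)
      have hpos : 0 < g.natDegree := by
        by_contra h0
        have h1 : f.natDegree = 0 := by omega
        rw [natDegree_eq_zero] at h1
        obtain ⟨c, rfl⟩ := h1
        rw [aeval_C] at hy'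
        simp at hψ
        exact hψ hy'
      have e : f.cancelLeads g = C f.leadingCoeff * g -
          C g.leadingCoeff * X ^ (g.natDegree - f.natDegree) * f := by
        rw [cancelLeads, Nat.sub_eq_zero_of_le hle, pow_zero, mul_one]
      have hlt := natDegree_cancelLeads_lt_of_natDegree_le_natDegree hle hpos
      have h1 := ih (f.cancelLeads g) (by omega) (by rw [e]; simp [hfw, hgw])
      rw [e] at h1
      simp only [map_sub, map_mul, hy', mul_zero, sub_zero, aeval_C] at h1
      exact (mul_eq_zero.1 h1).resolve_left hψ
  obtain ⟨χ, hχ⟩ := exists_algHom_of_le_range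
    ((aeval (R := B) w).restrictScalars K) ((aeval (R := B) y).restrictScalars K)
    (fun p hp => hker _ p (Nat.lt_succ_self _) hp)
    (Algebra.adjoin K (B ∪ {w})) (by
      rw [← Algebra.restrictScalars_adjoin, Algebra.adjoin_singleton_eq_range_aeval]
      exact fun _ h => h)
  refine ⟨χ, fun b => ?_, ?_⟩
  · have := hχ (C b)
    simp only [AlgHom.restrictScalars_apply, aeval_C] at this
    exact this (Algebra.subset_adjoin (Or.inl b.2))
  · have := hχ X
    simp only [AlgHom.restrictScalars_apply, aeval_X] at this
    exact this (Algebra.subset_adjoin (Or.inr rfl))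

/-- A point at which `S` does not vanish extends to fractions with denominator a power of `S`. -/
lemma exists_algHom_of_pow_mul_mem (S : B) (L : Subalgebra K E)
    (hL : ∀ x ∈ L, ∃ k : ℕ, (S : E) ^ k * x ∈ B) (ψ : B →ₐ[K] K) (hS : ψ S ≠ 0) :
    ∃ χ : L →ₐ[K] K, ∀ (x : L) (k : ℕ) (h : (S : E) ^ k * x ∈ B),
      χ x = ψ ⟨(S : E) ^ k * x, h⟩ / ψ S ^ k := by
  choose! k hk using hL
  have key : ∀ (x : E) (i j : ℕ) (hi : (S : E) ^ i * x ∈ B) (hj : (S : E) ^ j * x ∈ B),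
      ψ ⟨(S : E) ^ i * x, hi⟩ / ψ S ^ i = ψ ⟨(S : E) ^ j * x, hj⟩ / ψ S ^ j := by
    intro x i j hi hj
    rw [div_eq_div_iff (pow_ne_zero _ hS) (pow_ne_zero _ hS), ← map_pow, ← map_pow, ← map_mul,
      ← map_mul]
    congr 1
    ext
    push_cast
    ring
  let F : L → K := fun x => ψ ⟨_, hk x x.2⟩ / ψ S ^ k x
  have hF : ∀ (x : L) (i : ℕ) (h : (S : E) ^ i * x ∈ B),
      F x = ψ ⟨(S : E) ^ i * x, h⟩ / ψ S ^ i := fun x i h => key x _ _ _ h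
  have hadd : ∀ x y : L, F (x + y) = F x + F y := by
    intro x y
    have e : (S : E) ^ (k x + k y) * ((x + y : L) : E) = ((S ^ k y * ⟨_, hk x x.2⟩ +
        S ^ k x * ⟨_, hk y y.2⟩ : B) : E) := by
      push_cast; ring
    rw [hF _ (k x + k y) (e ▸ Subtype.prop _)]
    simp only [e, Subtype.coe_eta, map_add, map_mul, map_pow, F]
    field_simp
    ring
  have hmul : ∀ x y : L, F (x * y) = F x * F y := by
    intro x y
    have e : (S : E) ^ (k x + k y) * ((x * y : L) : E) =
        ((⟨_, hk x x.2⟩ * ⟨_, hk y y.2⟩ : B) : E) := by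
      push_cast; ring
    rw [hF _ (k x + k y) (e ▸ Subtype.prop _)]
    simp only [e, Subtype.coe_eta, map_mul, F]
    rw [pow_add, div_mul_div_comm]
  have hcomm : ∀ c : K, F (algebraMap K L c) = c := by
    intro c
    have e : (S : E) ^ 0 * ((algebraMap K L c : L) : E) = ((algebraMap K B c : B) : E) := by
      simp
    rw [hF _ 0 (by rw [e]; exact Subtype.prop _)]
    simp only [e, Subtype.coe_eta, AlgHom.commutes]
    simp
  exact ⟨{ toFun := F
           map_one' := by simpa using hcomm 1
           map_zero' := by simpa using hcomm 0
           map_add' := hadd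
           map_mul' := hmul
           commutes' := hcomm }, hF⟩

end Points

section Approximation

variable {K Γ₀ : Type*} [Field K] [LinearOrderedCommGroupWithZero Γ₀] {v : Valuation K Γ₀}

lemma exists_finset_mem_adjoin_union {E : Type*} [CommRing E] [Algebra K E] (B : Subalgebra K E)
    (s : Set E) (Q : Finset (Algebra.adjoin K (B ∪ s))) :
    ∃ T : Finset B, ∀ q ∈ Q, (q : E) ∈ Algebra.adjoin K (((↑) '' (T : Set B)) ∪ s : Set E) := by
  classical
  have mono : ∀ T T' : Finset B, T ⊆ T' →
      Algebra.adjoin K (((↑) '' (T : Set B)) ∪ s : Set E) ≤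
        Algebra.adjoin K (((↑) '' (T' : Set B)) ∪ s : Set E) := fun T T' h =>
    Algebra.adjoin_mono (Set.union_subset_union_left _ (Set.image_mono (by exact_mod_cast h)))
  have single : ∀ x ∈ Algebra.adjoin K (B ∪ s : Set E), ∃ T : Finset B,
      x ∈ Algebra.adjoin K (((↑) '' (T : Set B)) ∪ s : Set E) := by
    intro x hx
    induction hx using Algebra.adjoin_induction with
    | mem x hx =>
      rcases hx with hx | hx
      · exact ⟨{⟨x, hx⟩}, Algebra.subset_adjoin (Or.inl (by simp))⟩
      · exact ⟨∅, Algebra.subset_adjoin (Or.inr hx)⟩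
    | algebraMap r => exact ⟨∅, Subalgebra.algebraMap_mem _ r⟩
    | add x y _ _ hx hy =>
      obtain ⟨T, hT⟩ := hx
      obtain ⟨T', hT'⟩ := hy
      exact ⟨T ∪ T', add_mem (mono _ _ Finset.subset_union_left hT)
        (mono _ _ Finset.subset_union_right hT')⟩
    | mul x y _ _ hx hy =>
      obtain ⟨T, hT⟩ := hx
      obtain ⟨T', hT'⟩ := hy
      exact ⟨T ∪ T', mul_mem (mono _ _ Finset.subset_union_left hT)
        (mono _ _ Finset.subset_union_right hT')⟩
  choose T hT using fun q : Algebra.adjoin K (B ∪ s : Set E) => single q q.2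
  exact ⟨Q.biUnion T, fun q hq => mono _ _ (Finset.subset_biUnion_of_mem T hq) (hT q)⟩

variable (v) in
/-- Every finite subset of `B` can be specialised, to any prescribed order at `0`, along a family
of `K`-rational points of `B`. -/
def HasApprox (B : Subalgebra K (PowerSeries K)) : Prop :=
  ∀ (N : ℕ) (Q : Finset B), ∃ Ψ : K → (B →ₐ[K] K), ∀ q ∈ Q, Asymp v N (fun τ => Ψ τ q) q

variable (v) in
/-- The subalgebra of elements whose values along `Ψ` are approximated to order `N`. -/
def approxSubalgebra {B : Subalgebra K (PowerSeries K)} (N : ℕ) (Ψ : K → (B →ₐ[K] K)) :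
    Subalgebra K B where
  carrier := {q | Asymp v N (fun τ => Ψ τ q) q}
  mul_mem' ha hb := by simpa using Asymp.mul ha hb
  add_mem' ha hb := by simpa using Asymp.add ha hb
  algebraMap_mem' r := by simpa using Asymp.const r

/-- The value at `0` as a `K`-rational point. -/
noncomputable def constantCoeffAlgHom (K : Type*) [Field K] : PowerSeries K →ₐ[K] K :=
  { (PowerSeries.constantCoeff : PowerSeries K →+* K) with
    commutes' := fun r => by simp }

@[simp]
lemma constantCoeffAlgHom_apply (p : PowerSeries K) :
    constantCoeffAlgHom K p = PowerSeries.constantCoeff p := rfl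

namespace HasApprox

variable {B B' : Subalgebra K (PowerSeries K)}

lemma mono (h : B ≤ B') (hB' : HasApprox v B') : HasApprox v B := by
  classical
  intro N Q
  obtain ⟨Ψ, hΨ⟩ := hB' N (Q.image (Subalgebra.inclusion h))
  exact ⟨fun τ => (Ψ τ).comp (Subalgebra.inclusion h), fun q hq =>
    hΨ _ (Finset.mem_image_of_mem _ hq)⟩

lemma bot : HasApprox v (⊥ : Subalgebra K (PowerSeries K)) := by
  intro N Q
  refine ⟨fun _ => (constantCoeffAlgHom K).comp (Subalgebra.val _), fun q _ => ?_⟩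
  obtain ⟨q, hq⟩ := q
  obtain ⟨c, rfl⟩ := Algebra.mem_bot.1 hq
  simpa using Asymp.const c

lemma adjoin (hB : HasApprox v B) (s : Set (PowerSeries K))
    (hext : ∀ N, ∃ (M : ℕ) (Q : Finset B), ∀ Ψ : K → (B →ₐ[K] K),
      (∀ q ∈ Q, Asymp v M (fun τ => Ψ τ q) q) →
      ∃ Ψ' : K → (Algebra.adjoin K (B ∪ s : Set (PowerSeries K)) →ₐ[K] K),
        (∀ b : B, ∀ᶠ τ in puncturedZero v,
          Ψ' τ ⟨b, Algebra.subset_adjoin (Or.inl b.2)⟩ = Ψ τ b) ∧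
        ∀ x (hx : x ∈ s), Asymp v N
          (fun τ => Ψ' τ ⟨x, Algebra.subset_adjoin (Or.inr hx)⟩) x) :
    HasApprox v (Algebra.adjoin K (B ∪ s)) := by
  classical
  intro N Q
  obtain ⟨M, Q', h⟩ := hext N
  obtain ⟨T, hT⟩ := exists_finset_mem_adjoin_union B s Q
  obtain ⟨Ψ, hΨ⟩ := hB (max M N) (Q' ∪ T)
  obtain ⟨Ψ', h1, h2⟩ := h Ψ fun q hq =>
    (hΨ q (Finset.mem_union_left _ hq)).mono (le_max_left _ _)
  refine ⟨Ψ', fun q hq => ?_⟩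
  have key : Algebra.adjoin K (((↑) '' (T : Set B)) ∪ s : Set (PowerSeries K)) ≤
      (approxSubalgebra v N Ψ').map (Subalgebra.val _) := by
    rw [Algebra.adjoin_le_iff]
    rintro x (⟨t, ht, rfl⟩ | hx)
    · refine ⟨⟨t, Algebra.subset_adjoin (Or.inl t.2)⟩, ?_, rfl⟩
      refine ((hΨ t (Finset.mem_union_right _ ht)).mono (le_max_right _ _)).congr ?_
      filter_upwards [h1 t] with τ hτ using hτ.symm
    · exact ⟨⟨x, Algebra.subset_adjoin (Or.inr hx)⟩, h2 x hx, rfl⟩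
  obtain ⟨q', hq', e⟩ := key (hT q hq)
  have : q' = q := Subtype.ext e
  rwa [this] at hq'

lemma adjoin_algebraicIndependent (hB : HasApprox v B) {ι : Type*} {x : ι → PowerSeries K}
    (hx : AlgebraicIndependent B x) : HasApprox v (Algebra.adjoin K (B ∪ Set.range x)) := by
  refine hB.adjoin _ fun N => ⟨0, ∅, fun Ψ _ => ?_⟩
  choose P hP using fun i => PowerSeries.exists_polynomial_X_pow_dvd_sub N (x i)
  choose Ψ' h1 h2 using fun τ : K =>
    exists_algHom_of_algebraicIndependent B hx (Ψ τ) fun i => (P i).eval τ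
  refine ⟨Ψ', fun b => .of_forall fun τ => h1 τ b, ?_⟩
  rintro _ ⟨i, rfl⟩
  exact (Asymp.of_polynomial (hP i)).congr (.of_forall fun τ => (h2 τ i).symm)

lemma fractions (hB : HasApprox v B) {S : PowerSeries K} (hSB : S ∈ B) (hS : S ≠ 0)
    {L : Subalgebra K (PowerSeries K)} (hL : ∀ x ∈ L, ∃ k : ℕ, S ^ k * x ∈ B) :
    HasApprox v L := by
  classical
  intro N Q
  choose! k hk using hL
  let m := Q.sup fun q => k q
  have hm : ∀ q ∈ Q, S ^ m * (q : PowerSeries K) ∈ B := by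
    intro q hq
    obtain ⟨d, hd⟩ := Nat.exists_eq_add_of_le (Finset.le_sup (f := fun q : L => k q) hq)
    change m = _ at hd
    rw [hd, pow_add, mul_comm (S ^ _), mul_assoc]
    exact mul_mem (pow_mem hSB _) (hk q q.2)
  let M := max (N + (S ^ m).order.toNat + 1) (S.order.toNat + 1)
  obtain ⟨Ψ, hΨ⟩ := hB M
    (insert ⟨S, hSB⟩ (Q.attach.image fun q : {x // x ∈ Q} =>
      (⟨S ^ m * (q.1 : PowerSeries K), hm q.1 q.2⟩ : B)))
  have hS' := hΨ _ (Finset.mem_insert_self _ _)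
  have hex : ∀ τ, ∃ χ : L →ₐ[K] K, Ψ τ ⟨S, hSB⟩ ≠ 0 →
      ∀ (x : L) (k : ℕ) (h : S ^ k * x ∈ B),
        χ x = Ψ τ ⟨S ^ k * x, h⟩ / Ψ τ ⟨S, hSB⟩ ^ k := by
    intro τ
    by_cases h : Ψ τ ⟨S, hSB⟩ = 0
    · exact ⟨(constantCoeffAlgHom K).comp (Subalgebra.val _), fun h' => absurd h h'⟩
    · obtain ⟨χ, hχ⟩ := exists_algHom_of_pow_mul_mem B ⟨S, hSB⟩ L
        (fun x hx => ⟨k x, hk x hx⟩) (Ψ τ) h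
      exact ⟨χ, fun _ => hχ⟩
  choose Ψ' hΨ' using hex
  refine ⟨Ψ', fun q hq => ?_⟩
  have h1 := hΨ ⟨S ^ m * (q : PowerSeries K), hm q hq⟩ (Finset.mem_insert_of_mem
    (Finset.mem_image.2 ⟨⟨q, hq⟩, Finset.mem_attach _ _, rfl⟩))
  refine ((hS'.pow m).div (pow_ne_zero m hS) ?_ h1).congr ?_
  · exact (Nat.lt_succ_self _).trans_le (le_max_left _ _)
  · filter_upwards [hS'.eventually_ne_zero hS
      ((Nat.lt_succ_self _).trans_le (le_max_right _ _))] with τ hτ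
    exact (hΨ' τ hτ q m (hm q hq)).symm

end HasApprox

end Approximation

section AlgebraicStep

variable {K Γ₀ : Type*} [Field K] [LinearOrderedCommGroupWithZero Γ₀] {v : Valuation K Γ₀}

lemma BigO.of_le {N : ℕ} {X Y : K → K} (hY : BigO v N Y)
    (h : ∀ᶠ τ in puncturedZero v, v (X τ) ≤ v (Y τ)) : BigO v N X := by
  obtain ⟨C, hC⟩ := hY
  exact ⟨C, by filter_upwards [hC, h] with τ h1 h2 using h2.trans h1⟩

lemma BigO.eventually_lt {d : ℕ} {X : K → K} (hX : BigO v (d + 1) X) {c : K} (hc : c ≠ 0) :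
    ∀ᶠ τ in puncturedZero v, v (X τ) < v c * v τ ^ d := by
  obtain ⟨C, hC⟩ := hX
  filter_upwards [hC, eventually_mul_lt v C hc, eventually_ne_zero v] with τ h1 h2 h3
  refine h1.trans_lt ?_
  rw [pow_succ', ← mul_assoc]
  exact mul_lt_mul_of_pos_right h2 (pow_pos (zero_lt_iff.2 (v.ne_zero_iff.2 h3)) _)

lemma BigO.eventually_forall_lt {X : ℕ → K → K} (hX : ∀ j, BigO v 0 (X j)) (n : ℕ) :
    ∃ m : K, ∀ᶠ τ in puncturedZero v, ∀ j < n, v (X j τ) ≤ v m := by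
  induction n with
  | zero => exact ⟨0, by simp⟩
  | succ n ih =>
    obtain ⟨m, hm⟩ := ih
    obtain ⟨C, hC⟩ := hX n
    obtain ⟨M, h1, h2⟩ : ∃ M, v C ≤ v M ∧ v m ≤ v M := by
      rcases le_total (v C) (v m) with h | h
      exacts [⟨m, h, le_rfl⟩, ⟨C, le_rfl, h⟩]
    refine ⟨M, ?_⟩
    filter_upwards [hm, hC] with τ h3 h4 j hj
    rcases Nat.lt_succ_iff_lt_or_eq.1 hj with h | rfl
    · exact (h3 j h).trans h2
    · rw [pow_zero, mul_one] at h4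
      exact h4.trans h1

lemma Asymp.sum {N : ℕ} {ι : Type*} (s : Finset ι) {X : ι → K → K} {p : ι → PowerSeries K}
    (h : ∀ i ∈ s, Asymp v N (X i) (p i)) :
    Asymp v N (fun τ => ∑ i ∈ s, X i τ) (∑ i ∈ s, p i) := by
  classical
  induction s using Finset.induction_on with
  | empty => simpa using Asymp.const (v := v) (N := N) 0
  | insert a s ha ih =>
    simp only [Finset.sum_insert ha]
    exact (h a (Finset.mem_insert_self _ _)).add
      (ih fun i hi => h i (Finset.mem_insert_of_mem hi))

open Polynomial in
lemma Asymp.eval_map {B : Subalgebra K (PowerSeries K)} {N : ℕ} {Ψ : K → (B →ₐ[K] K)}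
    (g : Polynomial B) (hg : ∀ j, g.coeff j ∈ approxSubalgebra v N Ψ) {Y : K → K}
    {w : PowerSeries K} (hY : Asymp v N Y w) :
    Asymp v N (fun τ => (g.map (Ψ τ : B →+* K)).eval (Y τ)) (aeval w g) := by
  simp only [Polynomial.eval_map, eval₂_eq_sum_range, aeval_eq_sum_range]
  refine Asymp.sum _ fun i _ => ?_
  rw [Algebra.smul_def]
  exact Asymp.mul (hg i) (hY.pow i)

open Polynomial in
lemma exists_aeval_eq_zero_of_isAlgebraic {R E : Type*} [CommRing R] [CommRing E]
    [Algebra R E] {w : E} (hw : IsAlgebraic R w) :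
    ∃ f : Polynomial R, f ≠ 0 ∧ aeval w f = 0 ∧
      ∀ g : Polynomial R, aeval w g = 0 → g.degree < f.degree → g = 0 := by
  obtain ⟨f, ⟨hf0, hfw⟩, hmin⟩ := WellFounded.has_min (degree_lt_wf (R := R))
    {f | f ≠ 0 ∧ aeval w f = 0} hw
  exact ⟨f, hf0, hfw, fun g hg hlt => by_contra fun h0 => hmin g ⟨h0, hg⟩ hlt⟩

open Polynomial in
lemma aeval_derivative_ne_zero_of_minimal {R E : Type*} [CommRing R] [IsDomain R] [CharZero R]
    [CommRing E] [Algebra R E] [FaithfulSMul R E] {w : E} {f : Polynomial R} (hf0 : f ≠ 0)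
    (hfw : aeval w f = 0)
    (hmin : ∀ g : Polynomial R, aeval w g = 0 → g.degree < f.degree → g = 0) :
    aeval w f.derivative ≠ 0 := by
  intro h
  have h0 := hmin _ h (degree_derivative_lt hf0)
  obtain ⟨c, rfl⟩ := natDegree_eq_zero.1 (derivative_eq_zero.1 h0)
  rw [aeval_C, FaithfulSMul.algebraMap_eq_zero_iff] at hfw
  exact hf0 (by rw [hfw, C_0])

open Polynomial in
lemma HasApprox.adjoin_isAlgebraic [CharZero K] (hH : HenselianLocalRing ↥v.valuationSubring)
    {B : Subalgebra K (PowerSeries K)} (hB : HasApprox v B) {w : PowerSeries K}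
    (hw : IsAlgebraic B w) : HasApprox v (Algebra.adjoin K (B ∪ {w})) := by
  classical
  obtain ⟨f, hf0, hfw, hmin⟩ := exists_aeval_eq_zero_of_isAlgebraic hw
  have : CharZero B := charZero_of_injective_algebraMap (algebraMap K B).injective
  have hder := aeval_derivative_ne_zero_of_minimal hf0 hfw hmin
  have hlc : (f.leadingCoeff : PowerSeries K) ≠ 0 := by simpa using hf0
  set e := (aeval w f.derivative).order.toNat
  refine hB.adjoin _ fun N => ?_
  set M := max (N + e + 2 * e + 1) ((f.leadingCoeff : PowerSeries K).order.toNat + 1)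
  have hM1 : N + e + 2 * e + 1 ≤ M := le_max_left _ _
  have hM2 : (f.leadingCoeff : PowerSeries K).order.toNat + 1 ≤ M := le_max_right _ _
  refine ⟨M, f.coeffs, fun Ψ hΨ => ?_⟩
  have hcoeff : ∀ j, f.coeff j ∈ approxSubalgebra v M Ψ := fun j => by
    by_cases h : f.coeff j = 0
    · rw [h]; exact zero_mem _
    · exact hΨ _ (coeff_mem_coeffs h)
  obtain ⟨P, hP⟩ := PowerSeries.exists_polynomial_X_pow_dvd_sub M w
  let g : K → K[X] := fun τ => taylor (P.eval τ) (f.map (Ψ τ : B →+* K))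
  have hg : ∀ j, Asymp v M (fun τ => (g τ).coeff j) (aeval w (hasseDeriv j f)) := by
    intro j
    refine (Asymp.eval_map (Ψ := Ψ) (hasseDeriv j f) (fun i => ?_) (Asymp.of_polynomial hP)).congr
      (.of_forall fun τ => ?_)
    · rw [hasseDeriv_coeff]
      exact mul_mem (natCast_mem _ _) (hcoeff _)
    · have : (hasseDeriv j f).map (Ψ τ : B →+* K) = hasseDeriv j (f.map (Ψ τ : B →+* K)) := by
        ext i
        simp [hasseDeriv_coeff]
      simp only [g, taylor_coeff, this]
  have hg0 : BigO v M fun τ => (g τ).coeff 0 := by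
    refine (hg 0).bigO_of_dvd le_rfl ?_
    simp [hfw]
  have hg1 : Asymp v M (fun τ => (g τ).coeff 1) (aeval w f.derivative) := by
    simpa using hg 1
  obtain ⟨c, hc, hc1⟩ := hg1.eventually_eq hder (by omega)
  obtain ⟨m, hm⟩ := BigO.eventually_forall_lt (fun j => (hg j).bounded) (f.natDegree + 1)
  have hlt1 := (hg0.mono (M := e + 1) (by omega)).eventually_lt hc
  have hlt2 := (((BigO.const m).mul hg0).mono (M := 2 * e + 1) (by omega)).eventually_lt
    (pow_ne_zero 2 hc)
  have hlt3 : ∀ᶠ τ in puncturedZero v, Ψ τ f.leadingCoeff ≠ 0 :=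
    Asymp.eventually_ne_zero (hcoeff f.natDegree) hlc (by simpa using hM2)
  let good : K → (Algebra.adjoin K (B ∪ {w} : Set (PowerSeries K)) →ₐ[K] K) → Prop :=
    fun τ χ => (∀ b : B, χ ⟨b, Algebra.subset_adjoin (Or.inl b.2)⟩ = Ψ τ b) ∧
      v (χ ⟨w, Algebra.subset_adjoin (Or.inr rfl)⟩ - P.eval τ) * v ((g τ).coeff 1) ≤
        v ((g τ).coeff 0)
  have hgood : ∀ᶠ τ in puncturedZero v, ∃ χ, good τ χ := by
    filter_upwards [hc1, hm, hlt1, hlt2, hlt3] with τ t1 t2 t3 t4 t5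
    obtain ⟨z, hz, hzle⟩ := exists_root_of_coeff_le hH (g τ) m (fun j => by
      by_cases hj : j < f.natDegree + 1
      · exact t2 j hj
      · rw [coeff_eq_zero_of_natDegree_lt, map_zero]
        · exact zero_le
        · rw [natDegree_taylor]
          exact natDegree_map_le.trans_lt (by omega)) (t3.trans_eq t1.symm) (by
        rw [map_mul] at t4
        rw [t1, mul_pow, ← pow_mul, mul_comm e 2]
        simpa using t4)
    obtain ⟨χ, h1, h2⟩ := exists_algHom_of_root B w f hf0 hfw hmin (Ψ τ) t5 (z + P.eval τ)
      (by rw [← taylor_eval]; exact hz)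
    exact ⟨χ, h1, by rw [h2, add_sub_cancel_right]; exact hzle⟩
  have hex : ∀ τ, ∃ χ, (∃ χ', good τ χ') → good τ χ := fun τ => by
    by_cases h : ∃ χ', good τ χ'
    · exact ⟨h.choose, fun _ => h.choose_spec⟩
    · exact ⟨(constantCoeffAlgHom K).comp (Subalgebra.val _), fun h' => absurd h' h⟩
  choose Ψ' hΨ' using hex
  refine ⟨Ψ', fun b => ?_, ?_⟩
  · filter_upwards [hgood] with τ hτ using (hΨ' τ hτ).1 b
  · rintro _ rfl
    refine ⟨P, (pow_dvd_pow _ (by omega)).trans hP, ?_⟩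
    refine (hg1.bigO_div hder (by omega) (hg0.mono (M := N + e) (by omega))).of_le ?_
    filter_upwards [hgood, hg1.eventually_ne_zero hder (by omega)] with τ hτ h1
    rw [map_div₀, le_div_iff₀ (zero_lt_iff.2 (v.ne_zero_iff.2 h1))]
    exact (hΨ' τ hτ).2

end AlgebraicStep

section Differential

variable {K : Type*} [Field K]

/-- Derivations of a ring. Writing the type this way fixes the `ℤ`-module structure. -/
abbrev RingDerivation (E : Type*) [CommRing E] := Derivation ℤ E E

/-- An additive map satisfying the Leibniz rule is a derivation. -/
def RingDerivation.ofLeibniz {E : Type*} [CommRing E] (f : E → E)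
    (hadd : ∀ x y, f (x + y) = f x + f y) (hmul : ∀ x y, f (x * y) = f x * y + x * f y) :
    RingDerivation E :=
  Derivation.mk' (AddMonoidHom.mk' f hadd).toIntLinearMap fun x y => by
    simp only [AddMonoidHom.coe_toIntLinearMap, AddMonoidHom.mk'_apply, smul_eq_mul, hmul]
    ring

@[simp]
lemma RingDerivation.ofLeibniz_apply {E : Type*} [CommRing E] (f : E → E)
    (hadd : ∀ x y, f (x + y) = f x + f y) (hmul : ∀ x y, f (x * y) = f x * y + x * f y) (x : E) :
    RingDerivation.ofLeibniz f hadd hmul x = f x := rfl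

lemma RingDerivation.map_mul {E : Type*} [CommRing E] (D : RingDerivation E) (x y : E) :
    D (x * y) = x * D y + y * D x := D.leibniz x y

lemma mk_derivation_coeff_mul (d : RingDerivation K) (p q : PowerSeries K) :
    PowerSeries.mk (fun k => d (PowerSeries.coeff k (p * q))) =
      PowerSeries.mk (fun k => d (PowerSeries.coeff k p)) * q +
        p * PowerSeries.mk (fun k => d (PowerSeries.coeff k q)) := by
  ext k
  simp only [PowerSeries.coeff_mk, PowerSeries.coeff_mul, map_sum, Derivation.leibniz,
    smul_eq_mul, map_add, ← Finset.sum_add_distrib]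
  exact Finset.sum_congr rfl fun _ _ => by ring

/-- The extension of a derivation to power series which acts on coefficients and sends `X` to `1`. -/
noncomputable def powerSeriesDerivation (d : RingDerivation K) : RingDerivation (PowerSeries K) :=
  RingDerivation.ofLeibniz
    (fun p => PowerSeries.mk (fun k => d (PowerSeries.coeff k p)) + PowerSeries.derivative K p)
    (fun p q => by
      ext k
      simp only [map_add, PowerSeries.coeff_mk]
      ring)
    (fun p q => by
      rw [mk_derivation_coeff_mul, Derivation.leibniz, smul_eq_mul, smul_eq_mul]
      ring)

lemma coeff_powerSeriesDerivation (d : RingDerivation K) (k : ℕ) (p : PowerSeries K) :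
    PowerSeries.coeff k (powerSeriesDerivation d p) =
      d (PowerSeries.coeff k p) + PowerSeries.coeff (k + 1) p * (k + 1) := by
  simp [powerSeriesDerivation, PowerSeries.coeff_derivative]

lemma powerSeriesDerivation_algebraMap (d : RingDerivation K) (c : K) :
    powerSeriesDerivation d (algebraMap K (PowerSeries K) c) =
      algebraMap K (PowerSeries K) (d c) := by
  ext k
  rw [coeff_powerSeriesDerivation]
  rcases k with _ | k <;> simp [PowerSeries.coeff_C]

variable {E : Type*} [CommRing E] [Algebra K E]

lemma powerSeriesDerivation_mem_bot (d : RingDerivation K) :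
    ∀ p ∈ (⊥ : Subalgebra K (PowerSeries K)),
      powerSeriesDerivation d p ∈ (⊥ : Subalgebra K (PowerSeries K)) := by
  intro p hp
  obtain ⟨c, rfl⟩ := Algebra.mem_bot.1 hp
  rw [powerSeriesDerivation_algebraMap]
  exact Subalgebra.algebraMap_mem _ _

lemma derivation_mem_of_mem_adjoin (D : RingDerivation E) {s : Set E} {L : Subalgebra K E}
    (hs : s ⊆ L) (hK : ∀ c : K, D (algebraMap K E c) ∈ L) (hD : ∀ x ∈ s, D x ∈ L) :
    ∀ x ∈ Algebra.adjoin K s, D x ∈ L := by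
  intro x hx
  induction hx using Algebra.adjoin_induction with
  | mem x hx => exact hD x hx
  | algebraMap r => exact hK r
  | add x y _ _ hx hy => rw [map_add]; exact add_mem hx hy
  | mul x y hx' hy' hx hy =>
    rw [D.leibniz]
    exact add_mem (mul_mem (Algebra.adjoin_le hs hx') hy) (mul_mem (Algebra.adjoin_le hs hy') hx)

/-- The elements which are fractions with numerator in `C` and denominator a power of `S`. -/
def fractionSubalgebra (C : Subalgebra K E) (S : E) (hS : S ∈ C) : Subalgebra K E where
  carrier := {y | ∃ k : ℕ, S ^ k * y ∈ C}
  mul_mem' := by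
    rintro x y ⟨i, hi⟩ ⟨j, hj⟩
    exact ⟨i + j, by rw [pow_add, mul_mul_mul_comm]; exact mul_mem hi hj⟩
  add_mem' := by
    rintro x y ⟨i, hi⟩ ⟨j, hj⟩
    refine ⟨i + j, ?_⟩
    have : S ^ (i + j) * (x + y) = S ^ j * (S ^ i * x) + S ^ i * (S ^ j * y) := by ring
    rw [this]
    exact add_mem (mul_mem (pow_mem hS _) hi) (mul_mem (pow_mem hS _) hj)
  algebraMap_mem' r := ⟨0, by rw [pow_zero, one_mul]; exact C.algebraMap_mem r⟩

lemma le_fractionSubalgebra {C : Subalgebra K E} {S : E} (hS : S ∈ C) :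
    C ≤ fractionSubalgebra C S hS := fun y hy => ⟨0, by simpa using hy⟩

lemma derivation_mem_fractionSubalgebra (D : RingDerivation E) {C : Subalgebra K E} {S : E}
    (hS : S ∈ C) (hD : ∀ x ∈ C, D x ∈ fractionSubalgebra C S hS) :
    ∀ x ∈ fractionSubalgebra C S hS, D x ∈ fractionSubalgebra C S hS := by
  rintro y ⟨k, hk⟩
  have h1 := hD _ hk
  have h2 := hD _ (pow_mem hS k)
  rw [D.leibniz, smul_eq_mul, smul_eq_mul] at h1
  have h3 : S ^ k * D y ∈ fractionSubalgebra C S hS := by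
    have := sub_mem h1 (mul_mem (show y ∈ fractionSubalgebra C S hS from ⟨k, hk⟩) h2)
    rwa [add_sub_cancel_right] at this
  obtain ⟨j, hj⟩ := h3
  exact ⟨j + k, by rwa [pow_add, mul_assoc]⟩

open Polynomial in
lemma derivation_aeval_sub_mem (D : RingDerivation E) {B C : Subalgebra K E}
    {w : E} (hw : w ∈ C) (hD : ∀ b ∈ B, D b ∈ C) (f : Polynomial B) :
    D (aeval w f) - aeval w f.derivative * D w ∈ C := by
  induction f using Polynomial.induction_on' with
  | add p q hp hq =>
    have := add_mem hp hq
    convert this using 1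
    simp only [map_add]
    ring
  | monomial n b =>
    rw [derivative_monomial, aeval_monomial, aeval_monomial, D.leibniz, D.leibniz_pow]
    convert mul_mem (pow_mem hw n) (hD b b.2) using 1
    simp
    ring

lemma aeval_mem_adjoin (B : Subalgebra K E) (w : E) (f : Polynomial B) :
    Polynomial.aeval w f ∈ Algebra.adjoin K (B ∪ {w}) := by
  rw [← Algebra.restrictScalars_adjoin]
  exact Polynomial.aeval_mem_adjoin_singleton B w

variable {Γ₀ : Type*} [LinearOrderedCommGroupWithZero Γ₀] {v : Valuation K Γ₀}

/-- A differential subalgebra with `HasApprox` remains so after differentially adjoining an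
element. -/
lemma HasApprox.exists_differential_adjoin [CharZero K]
    (hH : HenselianLocalRing ↥v.valuationSubring) (d : RingDerivation K)
    {B : Subalgebra K (PowerSeries K)} (hB : HasApprox v B)
    (hBD : ∀ b ∈ B, powerSeriesDerivation d b ∈ B) (u : PowerSeries K) :
    ∃ L : Subalgebra K (PowerSeries K), HasApprox v L ∧ B ≤ L ∧
      (∀ b ∈ L, powerSeriesDerivation d b ∈ L) ∧ u ∈ L := by
  classical
  set D := powerSeriesDerivation d with hD
  have hK : ∀ (L : Subalgebra K (PowerSeries K)) (c : K),
      D (algebraMap K (PowerSeries K) c) ∈ L := fun L c => by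
    rw [hD, powerSeriesDerivation_algebraMap]
    exact L.algebraMap_mem _
  set x : ℕ → PowerSeries K := fun k => D^[k] u with hx
  have hxs : ∀ k, D (x k) = x (k + 1) := fun k => (Function.iterate_succ_apply' D k u).symm
  by_cases hind : ∀ n, AlgebraicIndepOn B x (Set.Iio n)
  · have hall : AlgebraicIndependent B x := by
      refine algebraicIndependent_of_finite_type fun t ht => ?_
      obtain ⟨n, hn⟩ := ht.bddAbove
      exact (hind (n + 1)).mono fun i hi => Nat.lt_succ_of_le (hn hi)
    refine ⟨_, hB.adjoin_algebraicIndependent hall,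
      fun b hb => Algebra.subset_adjoin (Or.inl hb), ?_,
      Algebra.subset_adjoin (Or.inr ⟨0, rfl⟩)⟩
    refine derivation_mem_of_mem_adjoin D Algebra.subset_adjoin (hK _) ?_
    rintro _ (hb | ⟨k, rfl⟩)
    · exact Algebra.subset_adjoin (Or.inl (hBD _ hb))
    · rw [hxs]
      exact Algebra.subset_adjoin (Or.inr ⟨k + 1, rfl⟩)
  · obtain ⟨n, hn, hn'⟩ : ∃ n, AlgebraicIndepOn B x (Set.Iio n) ∧
        ¬ AlgebraicIndepOn B x (Set.Iio (n + 1)) := by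
      by_contra! h
      refine hind fun n => ?_
      induction n with
      | zero =>
        rw [show Set.Iio 0 = (∅ : Set ℕ) by ext; simp]
        exact algebraicIndependent_empty_type_iff.2 (FaithfulSMul.algebraMap_injective _ _)
      | succ n ih => exact h n ih
    have hins : Set.Iio (n + 1) = insert n (Set.Iio n) := by
      ext i
      simp only [Set.mem_Iio, Set.mem_insert_iff]
      omega
    set C : Subalgebra K (PowerSeries K) :=
      (Algebra.adjoin B (x '' Set.Iio n)).restrictScalars K with hC
    have hCeq : C = Algebra.adjoin K (B ∪ x '' Set.Iio n) := Algebra.restrictScalars_adjoin _ _ _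
    have hCapprox : HasApprox v C := by
      have := hB.adjoin_algebraicIndependent hn
      rwa [Set.range_comp', Subtype.range_coe, ← hCeq] at this
    have hw : IsAlgebraic C (x n) := by
      by_contra h
      rw [hins] at hn'
      exact hn' ((AlgebraicIndepOn.insert_iff (by simp)).2 ⟨hn, h⟩)
    have hC'approx := hCapprox.adjoin_isAlgebraic hH hw
    obtain ⟨f, hf0, hfw, hmin⟩ := exists_aeval_eq_zero_of_isAlgebraic hw
    have : CharZero C := charZero_of_injective_algebraMap (algebraMap K C).injective
    have hS0 := aeval_derivative_ne_zero_of_minimal hf0 hfw hmin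
    have hS := aeval_mem_adjoin C (x n) (Polynomial.derivative f)
    set C' := Algebra.adjoin K (C ∪ {x n} : Set (PowerSeries K)) with hC'
    set S := Polynomial.aeval (x n) (Polynomial.derivative f)
    have hBC : (B : Set (PowerSeries K)) ⊆ C := fun b hb => by
      rw [hCeq]
      exact Algebra.subset_adjoin (Or.inl hb)
    have hCC' : (C : Set (PowerSeries K)) ⊆ C' := fun b hb => Algebra.subset_adjoin (Or.inl hb)
    have hxC : ∀ k < n, x k ∈ C := fun k hk => by
      rw [hCeq]
      exact Algebra.subset_adjoin (Or.inr ⟨k, hk, rfl⟩)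
    have hxC' : ∀ k ≤ n, x k ∈ C' := fun k hk => by
      rcases hk.lt_or_eq with hk | rfl
      · exact hCC' (hxC k hk)
      · exact Algebra.subset_adjoin (Or.inr rfl)
    have hDC : ∀ b ∈ C, D b ∈ C' := by
      have := derivation_mem_of_mem_adjoin D (s := B ∪ x '' Set.Iio n) (L := C') ?_ (hK _) ?_
      · rwa [← hCeq] at this
      · rintro _ (hb | ⟨k, hk, rfl⟩)
        · exact hCC' (hBC hb)
        · exact hCC' (hxC k hk)
      · rintro _ (hb | ⟨k, hk, rfl⟩)
        · exact hCC' (hBC (hBD _ hb))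
        · rw [hxs]
          exact hxC' _ hk
    have hDw : S * D (x n) ∈ C' := by
      have := derivation_aeval_sub_mem D (hxC' n le_rfl) hDC f
      rw [hfw, map_zero, zero_sub] at this
      simpa using neg_mem this
    have hDL := derivation_mem_fractionSubalgebra D hS
      (derivation_mem_of_mem_adjoin D
        (Algebra.subset_adjoin.trans (le_fractionSubalgebra hS)) (hK _) (by
          rintro _ (hb | rfl)
          · exact le_fractionSubalgebra hS (hDC _ hb)
          · exact ⟨1, by rwa [pow_one]⟩))
    refine ⟨fractionSubalgebra C' S hS, hC'approx.fractions hS hS0 fun _ h => h,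
      fun b hb => le_fractionSubalgebra hS (hCC' (hBC hb)), hDL,
      le_fractionSubalgebra hS (hxC' 0 (Nat.zero_le n))⟩

end Differential

section Taylor

variable {K A : Type*} [Field K] [CommRing A] [Algebra K A]

/-- The coefficients of the Taylor morphism of a point `φ`. -/
def taylorCoeff (d : K → K) (e : A → A) (φ : A → K) : ℕ → A → K
  | 0, x => φ x
  | k + 1, x => (taylorCoeff d e φ k (e x) - d (taylorCoeff d e φ k x)) / (k + 1)

/-- The Taylor morphism of a point `φ`, as a function. -/
def taylorSeries (d : K → K) (e : A → A) (φ : A → K) (x : A) : PowerSeries K :=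
  PowerSeries.mk fun k => taylorCoeff d e φ k x

variable (d : RingDerivation K) (e : RingDerivation A) (φ : A →ₐ[K] K)

lemma coeff_succ_taylorSeries (k : ℕ) (x : A) :
    PowerSeries.coeff (k + 1) (taylorSeries d e φ x) =
      (PowerSeries.coeff k (taylorSeries d e φ (e x)) -
        d (PowerSeries.coeff k (taylorSeries d e φ x))) / (k + 1) := by
  simp [taylorSeries, taylorCoeff]

variable [CharZero K]

lemma powerSeriesDerivation_taylorSeries (x : A) :
    powerSeriesDerivation d (taylorSeries d e φ x) = taylorSeries d e φ (e x) := by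
  ext k
  have : (k + 1 : K) ≠ 0 := Nat.cast_add_one_ne_zero k
  rw [coeff_powerSeriesDerivation]
  simp only [taylorSeries, PowerSeries.coeff_mk, taylorCoeff]
  field_simp
  ring

lemma coeff_succ_eq (k : ℕ) (p : PowerSeries K) :
    PowerSeries.coeff (k + 1) p = (PowerSeries.coeff k (powerSeriesDerivation d p) -
      d (PowerSeries.coeff k p)) / (k + 1) := by
  have : (k + 1 : K) ≠ 0 := Nat.cast_add_one_ne_zero k
  rw [coeff_powerSeriesDerivation]
  field_simp
  ring

lemma taylorSeries_add (x y : A) :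
    taylorSeries d e φ (x + y) = taylorSeries d e φ x + taylorSeries d e φ y := by
  ext k
  induction k generalizing x y with
  | zero => simp [taylorSeries, taylorCoeff]
  | succ k ih =>
    rw [coeff_succ_taylorSeries, map_add e, ih, ih, coeff_succ_eq d k (_ + _), map_add
      (powerSeriesDerivation d), powerSeriesDerivation_taylorSeries,
      powerSeriesDerivation_taylorSeries]

lemma taylorSeries_mul (x y : A) :
    taylorSeries d e φ (x * y) = taylorSeries d e φ x * taylorSeries d e φ y := by
  ext k
  induction k generalizing x y with
  | zero => simp [taylorSeries, taylorCoeff]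
  | succ k ih =>
    rw [coeff_succ_taylorSeries, e.map_mul, taylorSeries_add, map_add, ih, ih, ih,
      coeff_succ_eq d k (_ * _), RingDerivation.map_mul, powerSeriesDerivation_taylorSeries,
      powerSeriesDerivation_taylorSeries, map_add]

lemma taylorSeries_algebraMap (h : ∀ c : K, e (algebraMap K A c) = algebraMap K A (d c)) (c : K) :
    taylorSeries d e φ (algebraMap K A c) = algebraMap K (PowerSeries K) c := by
  ext k
  induction k generalizing c with
  | zero => simp [taylorSeries, taylorCoeff]
  | succ k ih =>
    rw [coeff_succ_taylorSeries, h, ih, ih, coeff_succ_eq d k, powerSeriesDerivation_algebraMap]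

/-- The Taylor morphism of a point `φ`. -/
def taylorAlgHom (h : ∀ c : K, e (algebraMap K A c) = algebraMap K A (d c)) :
    A →ₐ[K] PowerSeries K where
  toFun := taylorSeries d e φ
  map_one' := by simpa using taylorSeries_algebraMap d e φ h 1
  map_zero' := by simpa using taylorSeries_algebraMap d e φ h 0
  map_add' := taylorSeries_add d e φ
  map_mul' := taylorSeries_mul d e φ
  commutes' := taylorSeries_algebraMap d e φ h

lemma taylorAlgHom_iterate (h : ∀ c : K, e (algebraMap K A c) = algebraMap K A (d c)) (k : ℕ)
    (x : A) : taylorAlgHom d e φ h (e^[k] x) =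
      (powerSeriesDerivation d)^[k] (taylorAlgHom d e φ h x) := by
  induction k with
  | zero => rfl
  | succ k ih =>
    rw [Function.iterate_succ_apply', Function.iterate_succ_apply', ← ih]
    exact (powerSeriesDerivation_taylorSeries d e φ _).symm

lemma coeff_zero_taylorAlgHom (h : ∀ c : K, e (algebraMap K A c) = algebraMap K A (d c)) (x : A) :
    PowerSeries.coeff 0 (taylorAlgHom d e φ h x) = φ x := by
  simp [taylorAlgHom, taylorSeries, taylorCoeff]

lemma coeff_one_taylorAlgHom (h : ∀ c : K, e (algebraMap K A c) = algebraMap K A (d c)) (x : A) :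
    PowerSeries.coeff 1 (taylorAlgHom d e φ h x) = φ (e x) - d (φ x) := by
  simp [taylorAlgHom, taylorSeries, taylorCoeff]

lemma range_taylorAlgHom_le (h : ∀ c : K, e (algebraMap K A c) = algebraMap K A (d c)) {n : ℕ}
    (a : Fin n → A)
    (hgen : Algebra.adjoin K (Set.range fun p : Fin n × ℕ => e^[p.2] (a p.1)) = ⊤)
    {B : Subalgebra K (PowerSeries K)} (hB : ∀ b ∈ B, powerSeriesDerivation d b ∈ B)
    (ha : ∀ i, taylorAlgHom d e φ h (a i) ∈ B) : (taylorAlgHom d e φ h).range ≤ B := by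
  rw [← Algebra.map_top, ← hgen, AlgHom.map_adjoin, Algebra.adjoin_le_iff]
  rintro _ ⟨_, ⟨⟨i, k⟩, rfl⟩, rfl⟩
  simp only [taylorAlgHom_iterate]
  induction k with
  | zero => exact ha i
  | succ k ih =>
    rw [Function.iterate_succ_apply']
    exact hB _ ih

variable {Γ₀ : Type*} [LinearOrderedCommGroupWithZero Γ₀] {v : Valuation K Γ₀}

lemma HasApprox.range_taylorAlgHom (hH : HenselianLocalRing ↥v.valuationSubring)
    (h : ∀ c : K, e (algebraMap K A c) = algebraMap K A (d c)) {n : ℕ} (a : Fin n → A)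
    (hgen : Algebra.adjoin K (Set.range fun p : Fin n × ℕ => e^[p.2] (a p.1)) = ⊤) :
    HasApprox v (taylorAlgHom d e φ h).range := by
  classical
  have key : ∀ s : Finset (Fin n), ∃ B : Subalgebra K (PowerSeries K), HasApprox v B ∧
      (∀ b ∈ B, powerSeriesDerivation d b ∈ B) ∧ ∀ i ∈ s, taylorAlgHom d e φ h (a i) ∈ B := by
    intro s
    induction s using Finset.induction_on with
    | empty =>
      exact ⟨⊥, HasApprox.bot, powerSeriesDerivation_mem_bot d, by simp⟩
    | insert i s _ ih =>
      obtain ⟨B, hB, hBD, hs⟩ := ih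
      obtain ⟨L, hL, hBL, hLD, hi⟩ :=
        hB.exists_differential_adjoin hH d hBD (taylorAlgHom d e φ h (a i))
      refine ⟨L, hL, hLD, fun j hj => ?_⟩
      rcases Finset.mem_insert.1 hj with rfl | hj
      exacts [hi, hBL (hs j hj)]
  obtain ⟨B, hB, hBD, ha⟩ := key Finset.univ
  exact hB.mono (range_taylorAlgHom_le d e φ h a hgen hBD fun i => ha i (Finset.mem_univ i))

/-- Any point can be approximated by points taking different values on the generators, unless
the Taylor morphism is constant on the generators. -/
lemma taylorAlgHom_eq_C_of_isolated [(puncturedZero v).NeBot]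
    (hH : HenselianLocalRing ↥v.valuationSubring)
    (h : ∀ c : K, e (algebraMap K A c) = algebraMap K A (d c)) {n : ℕ} (a : Fin n → A)
    (hgen : Algebra.adjoin K (Set.range fun p : Fin n × ℕ => e^[p.2] (a p.1)) = ⊤)
    {c : K} (hc : c ≠ 0)
    (hiso : ∀ ψ : A →ₐ[K] K, (∀ i, v (φ (a i) - ψ (a i)) < v c) → ψ = φ) (i : Fin n) :
    taylorAlgHom d e φ h (a i) = PowerSeries.C (φ (a i)) := by
  classical
  by_contra hne
  set T := taylorAlgHom d e φ h
  set p := T (a i) - PowerSeries.C (φ (a i)) with hp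
  have hp0 : p ≠ 0 := sub_ne_zero.2 hne
  obtain ⟨Ψ, hΨ⟩ := HasApprox.range_taylorAlgHom (v := v) d e φ hH h a hgen (p.order.toNat + 1)
    (Finset.univ.image fun j => T.rangeRestrict (a j))
  have hΨ' : ∀ j, Asymp v (p.order.toNat + 1)
      (fun τ => ((Ψ τ).comp T.rangeRestrict) (a j)) (T (a j)) := fun j =>
    hΨ _ (Finset.mem_image_of_mem _ (Finset.mem_univ j))
  have h1 : ∀ j, ∀ᶠ τ in puncturedZero v,
      v (φ (a j) - ((Ψ τ).comp T.rangeRestrict) (a j)) < v c := fun j => by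
    have := ((hΨ' j).bigO_sub_coeff (d := 0) (Nat.succ_pos _) (by simp)).eventually_lt hc
    filter_upwards [this] with τ hτ
    rw [Valuation.map_sub_swap]
    simpa [T, ← coeff_zero_taylorAlgHom d e φ h] using hτ
  have h2 : ∀ᶠ τ in puncturedZero v,
      ((Ψ τ).comp T.rangeRestrict) (a i) + -φ (a i) ≠ 0 := by
    refine Asymp.eventually_ne_zero (p := p) (N := p.order.toNat + 1) ?_ hp0 (Nat.lt_succ_self _)
    have hpe : p = T (a i) + PowerSeries.C (-φ (a i)) := by rw [hp, map_neg, sub_eq_add_neg]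
    have := (hΨ' i).add (Asymp.const (-φ (a i)))
    rwa [← hpe] at this
  obtain ⟨τ, hτ1, hτ2⟩ := ((Filter.eventually_all.2 h1).and h2).exists
  rw [hiso _ hτ1] at hτ2
  exact hτ2 (add_neg_cancel _)

end Taylor

lemma puncturedZero_neBot {K Γ₀ : Type*} [Field K] [LinearOrderedCommGroupWithZero Γ₀]
    {v : Valuation K Γ₀} (h : ∀ ε : K, ε ≠ 0 → ∃ τ, τ ≠ 0 ∧ v τ < v ε) :
    (puncturedZero v).NeBot := by
  rw [(puncturedZero_hasBasis v).neBot_iff]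
  exact fun {ε} _ => h ε ε.2

/-!
STATEMENT 17.  Multiplicative valuations: the additive isolation condition
`v(φ(a_i) − ψ(a_i)) > γ`, `γ ∈ vK`, becomes `v (φ (a i) - ψ (a i)) < v c` for some
`c ∈ K^×`.  `(K, v, δ)` differentially henselian = henselian (`HenselianLocalRing` of
the valuation subring) plus the (DL) scheme, where a differential polynomial of order
`n` is given by its algebraic avatar in `MvPolynomial (Fin (n+1)) K`.  `(A, dA)` is a
differential `K`-algebra, and `ā = (a i)` is a finite differential generating set:
the `dA^[k] (a i)` generate `A` as a `K`-algebra.  `K`-rational points are `K`-algebra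
homomorphisms `A →ₐ[K] K`, and the conclusion says the isolated point `φ` is
differential.
-/

open MvPolynomial

theorem statement17 {K Γ₀ A : Type*} [Field K] [CharZero K]
    [LinearOrderedCommGroupWithZero Γ₀] (v : Valuation K Γ₀)
    [CommRing A] [Algebra K A]
    (hH : HenselianLocalRing ↥v.valuationSubring)
    (δ : K → K) (hδadd : ∀ x y, δ (x + y) = δ x + δ y)
    (hδmul : ∀ x y, δ (x * y) = δ x * y + x * δ y)
    (hDH : ∀ (n : ℕ) (f : MvPolynomial (Fin (n + 1)) K) (b : Fin (n + 1) → K),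
      eval b f = 0 → eval b (pderiv (Fin.last n) f) ≠ 0 →
      ∀ c : K, c ≠ 0 → ∃ x : K,
        eval (fun i : Fin (n + 1) => δ^[(i : ℕ)] x) f = 0 ∧
        ∀ i : Fin (n + 1), v (δ^[(i : ℕ)] x - b i) < v c)
    (dA : A → A) (hdadd : ∀ x y, dA (x + y) = dA x + dA y)
    (hdmul : ∀ x y, dA (x * y) = dA x * y + x * dA y)
    (hcompat : ∀ x : K, dA (algebraMap K A x) = algebraMap K A (δ x))
    {n : ℕ} (a : Fin n → A)
    (hgen : Algebra.adjoin K
      (Set.range fun p : Fin n × ℕ => dA^[p.2] (a p.1)) = ⊤)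
    (φ : A →ₐ[K] K) (c : K) (hc : c ≠ 0)
    (hiso : ∀ ψ : A →ₐ[K] K, (∀ i, v (φ (a i) - ψ (a i)) < v c) → ψ = φ) :
    ∀ x : A, φ (dA x) = δ (φ x) := by
  have hδ0 : δ 0 = 0 := by simpa using hδadd 0 0
  have hnt : (puncturedZero v).NeBot := puncturedZero_neBot fun ε hε => by
    obtain ⟨c', hc', h1, h2⟩ : ∃ c' : K, c' ≠ 0 ∧ v c' ≤ v ε ∧ v c' ≤ 1 := by
      rcases le_total (v ε) 1 with h | h
      · exact ⟨ε, hε, le_rfl, h⟩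
      · exact ⟨1, one_ne_zero, by rwa [map_one], (map_one v).le⟩
    obtain ⟨x, -, hx⟩ := hDH 1 (X 1 - C 1) ![0, 1] (by simp) (by simp) c' hc'
    refine ⟨x, ?_, ?_⟩
    · rintro rfl
      have := hx 1
      simp [hδ0] at this
      exact absurd (this.trans_le h2) (lt_irrefl _)
    · simpa using (hx 0).trans_le h1
  let d := RingDerivation.ofLeibniz δ hδadd hδmul
  let e := RingDerivation.ofLeibniz dA hdadd hdmul
  intro x
  have hrange := range_taylorAlgHom_le d e φ hcompat a hgen (powerSeriesDerivation_mem_bot d)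
    fun i => Algebra.mem_bot.2 ⟨φ (a i),
      (taylorAlgHom_eq_C_of_isolated d e φ hH hcompat a hgen hc hiso i).symm⟩
  obtain ⟨r, hr⟩ := Algebra.mem_bot.1 (hrange ⟨x, rfl⟩)
  replace hr : algebraMap K (PowerSeries K) r = taylorAlgHom d e φ hcompat x := hr
  have h1 := coeff_one_taylorAlgHom d e φ hcompat x
  rw [← hr] at h1
  exact sub_eq_zero.1 (h1.symm.trans (by simp))
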